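/- There is no probability mass function q on Bool × Bool × Bool × Bool, with components (A, B, C, D), such that q{A = true ∧ B = true} = 1/12, q{A = true ∧ D = false} = 0, q{B = true ∧ C = false} = 0, and q{C = true ∧ D = true} = 0. (Hence the four Born-rule predictions of the extended Wigner's-friend scenario based on the Hardy state are incompatible with a single global joint assignment of the four observed outcomes.) -/

import Mathlib

open scoped BigOperators ENNReal

/-- There is no PMF on four Boolean outcomes (A, B, C, D) realizing the four Born-rule
predictions of the Hardy-state extended Wigner's-friend scenario: P(A ∧ B) = 1/12,
P(A ∧ ¬D) = 0, P(B ∧ ¬C) = 0, P(C ∧ D) = 0. -/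
theorem no_global_assignment :
    ¬ ∃ q : PMF (Bool × Bool × Bool × Bool),
      (∑ x ∈ Finset.univ.filter
        (fun x : Bool × Bool × Bool × Bool => x.1 = true ∧ x.2.1 = true), q x
          = (1 : ℝ≥0∞) / 12) ∧
      (∑ x ∈ Finset.univ.filter
        (fun x : Bool × Bool × Bool × Bool => x.1 = true ∧ x.2.2.2 = false), q x = 0) ∧
      (∑ x ∈ Finset.univ.filter
        (fun x : Bool × Bool × Bool × Bool => x.2.1 = true ∧ x.2.2.1 = false), q x = 0) ∧
      (∑ x ∈ Finset.univ.filter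
        (fun x : Bool × Bool × Bool × Bool => x.2.2.1 = true ∧ x.2.2.2 = true), q x = 0) := by
  rintro ⟨q, hAB, hAD, hBC, hCD⟩
  rw [Finset.sum_eq_zero_iff] at hAD hBC hCD
  refine absurd hAB ?_
  rw [Finset.sum_eq_zero]
  · exact (ENNReal.div_pos one_ne_zero (ENNReal.ofNat_ne_top)).ne
  · rintro ⟨a, b, c, d⟩ hx
    obtain ⟨ha, hb⟩ := (Finset.mem_filter.mp hx).2
    cases d
    · exact hAD _ (by simpa using ha)
    cases c
    · exact hBC _ (by simpa using hb)
    · exact hCD _ (by simp)
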